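/- arXiv:2307.16390 — 2 statements merged into one kernel-verified Lean document; each statement's English description precedes it below -/
import Mathlib

section
/- For every integer n ≥ 2 and every 0 < q < 1/2 with p = 1 - q, we have pⁿ·(1 + qⁿ - pⁿ)·h(qⁿ) > qⁿ·(1 + pⁿ - qⁿ)·h(pⁿ). (The Prelov conjecture.) -/
noncomputable def binH (x : ℝ) : ℝ := -x * Real.log x - (1 - x) * Real.log (1 - x)

open Real Set Filter Topology

/-- The tail `∑ x^(k+1)/(k+3)` of the logarithm series. -/
noncomputable def tN (x : ℝ) : ℝ := (-log (1 - x) - x - x ^ 2 / 2) / x ^ 2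

lemma tN_hasSum (x : ℝ) (h0 : 0 < x) (h1 : x < 1) :
    HasSum (fun k : ℕ => x ^ (k + 1) / ((k : ℝ) + 3)) (tN x) := by
  have h := Real.hasSum_pow_div_log_of_abs_lt_one (x := x) (by rw [abs_of_pos h0]; exact h1)
  have h2 := (hasSum_nat_add_iff' 2).mpr h
  have h3 := h2.div_const (x ^ 2)
  have e : (-log (1 - x) - ∑ i ∈ Finset.range 2, x ^ (i + 1) / ((i : ℝ) + 1)) / x ^ 2 = tN x := by
    unfold tN
    simp [Finset.sum_range_succ]
    ring
  rw [e] at h3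
  have e2 : ∀ k : ℕ, x ^ (k + 1) / ((k : ℝ) + 3) =
      x ^ (k + 2 + 1) / (((k + 2 : ℕ) : ℝ) + 1) / x ^ 2 := by
    intro k
    push_cast
    have : (k : ℝ) + 3 ≠ 0 := by positivity
    have : (k : ℝ) + 2 + 1 ≠ 0 := by positivity
    field_simp
    ring
  simp only [e2]
  exact h3

lemma geo_hasSum (x : ℝ) (h0 : 0 < x) (h1 : x < 1) :
    HasSum (fun k : ℕ => x ^ (k + 1) / 3) (x / (1 - x) / 3) := by
  have h := ((hasSum_geometric_of_lt_one h0.le h1).mul_left x).div_const 3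
  have e : ∀ k : ℕ, x ^ (k + 1) / 3 = x * x ^ k / 3 := fun k => by ring
  simp only [e, div_eq_mul_inv x (1 - x)]
  exact h

lemma tN_nonneg (x : ℝ) (h0 : 0 < x) (h1 : x < 1) : 0 ≤ tN x :=
  (tN_hasSum x h0 h1).nonneg (fun k => by positivity)

lemma tN_mono (x y : ℝ) (h0 : 0 < x) (hxy : x ≤ y) (h1 : y < 1) : tN x ≤ tN y :=
  hasSum_le (fun k => by gcongr) (tN_hasSum x h0 (by linarith)) (tN_hasSum y (by linarith) h1)

lemma tN_le (x : ℝ) (h0 : 0 < x) (h1 : x < 1) : tN x ≤ x / (1 - x) / 3 :=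
  hasSum_le (fun k => by
    have : (0:ℝ) ≤ k := Nat.cast_nonneg k
    gcongr; linarith) (tN_hasSum x h0 h1) (geo_hasSum x h0 h1)

lemma tN_sub_le (x y : ℝ) (h0 : 0 < x) (hxy : x ≤ y) (h1 : y < 1) :
    tN y - tN x ≤ y / (1 - y) / 3 - x / (1 - x) / 3 :=
  hasSum_le (fun k => by
    have : (0:ℝ) ≤ k := Nat.cast_nonneg k
    have h : x ^ (k+1) ≤ y ^ (k+1) := by gcongr
    rw [← sub_div, ← sub_div]
    apply div_le_div_of_nonneg_left <;> linarith)
    ((tN_hasSum y (by linarith) h1).sub (tN_hasSum x h0 (by linarith)))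
    ((geo_hasSum y (by linarith) h1).sub (geo_hasSum x h0 (by linarith)))

lemma log_eq_tN (x : ℝ) (h0 : 0 < x) : -log (1 - x) / x ^ 2 = 1 / x + 1 / 2 + tN x := by
  unfold tN
  field_simp
  ring

/-- region inequality -/
lemma region (a b : ℝ) (hb : 0 < b) (hab : b < a) (hs : a + b < 1)
    (hc : 4 * (a * b) ≤ (1 - a - b) ^ 2) :
    (1 + (a - b)) * (-log (1 - a) / a ^ 2) < (1 - (a - b)) * (-log (1 - b) / b ^ 2) := by
  have ha : 0 < a := hb.trans hab
  have ha1 : a < 1 := by linarith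
  have hb1 : b < 1 := by linarith
  rw [log_eq_tN a ha, log_eq_tN b hb]
  have h1 := tN_le a ha ha1
  have h2 := tN_le b hb hb1
  have h3 := tN_sub_le b a hb hab.le ha1
  have hd : 0 < a - b := by linarith
  have hP : 0 < a * b := by positivity
  have hQ : 0 < (1 - a) * (1 - b) := mul_pos (by linarith) (by linarith)
  have key : (1 + a + b - 2 * (a * b)) / (3 * ((1 - a) * (1 - b))) < (1 - a - b - a * b) / (a * b) := by
    rw [div_lt_div_iff₀ (by positivity) hP]
    have : a * b < 1 := by nlinarith
    nlinarith [mul_pos hP (by linarith : 0 < 1 - a - b), mul_pos hP (by linarith : 0 < 1 - a * b)]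
  have key2 := mul_lt_mul_of_pos_left key hd
  have e1 : (a - b) * ((1 + a + b - 2 * (a * b)) / (3 * ((1 - a) * (1 - b)))) =
      (a / (1 - a) / 3 - b / (1 - b) / 3) + (a - b) * (a / (1 - a) / 3 + b / (1 - b) / 3) := by
    have : 1 - a ≠ 0 := by linarith
    have : 1 - b ≠ 0 := by linarith
    field_simp
    ring
  have e2 : (a - b) * ((1 - a - b - a * b) / (a * b)) = 1 / b - 1 / a - (a - b) * (1 / a + 1 / b + 1) := by
    field_simp
    ring
  rw [e1, e2] at key2
  have h4 := mul_le_mul_of_nonneg_left (add_le_add h1 h2) hd.le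
  nlinarith

noncomputable def phi (x : ℝ) : ℝ := -log x - (1 - x) * log (1 - x) / x

lemma phi_deriv (x : ℝ) (h0 : 0 < x) (h1 : x < 1) : HasDerivAt phi (log (1 - x) / x ^ 2) x := by
  have hx : 1 - x ≠ 0 := by linarith
  have hl : HasDerivAt (fun y : ℝ => 1 - y) (-1) x := by
    simpa using (hasDerivAt_id x).const_sub 1
  have h := (hasDerivAt_log h0.ne').neg.sub ((hl.mul (hl.log hx)).div (hasDerivAt_id x) h0.ne')
  refine h.congr_deriv ?_
  simp only [Pi.mul_apply, id]
  field_simp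
  ring

noncomputable def gg (x : ℝ) : ℝ := -2 * (x * log x) - (1 - x ^ 2) * (log (1 - x ^ 2) / x)

lemma gg_phi (x : ℝ) (h0 : 0 < x) : gg x = x * phi (x ^ 2) := by
  unfold gg phi
  rw [log_pow]
  push_cast
  field_simp

lemma gg_deriv (x : ℝ) (h0 : 0 < x) (h1 : x < 1) :
    HasDerivAt gg (-2 * log x + (1 + 1 / x ^ 2) * log (1 - x ^ 2)) x := by
  have hx : 1 - x ^ 2 ≠ 0 := by nlinarith
  have hl : HasDerivAt (fun y : ℝ => 1 - y ^ 2) (-(2 * x)) x := by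
    simpa using (hasDerivAt_pow 2 x).const_sub 1
  have h := (((hasDerivAt_id x).mul (hasDerivAt_log h0.ne')).const_mul (-2)).sub
    (hl.mul ((hl.log hx).div (hasDerivAt_id x) h0.ne'))
  refine h.congr_deriv ?_
  simp only [id, Pi.div_apply]
  field_simp
  ring

lemma gg1_deriv (x : ℝ) (h0 : 0 < x) (h1 : x < 1) :
    HasDerivAt (fun x : ℝ => -2 * log x + (1 + 1 / x ^ 2) * log (1 - x ^ 2))
      (-4 / (x * (1 - x ^ 2)) + 2 * x * (-log (1 - x ^ 2) / (x ^ 2) ^ 2)) x := by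
  have hx : 1 - x ^ 2 ≠ 0 := by nlinarith
  have hl : HasDerivAt (fun y : ℝ => 1 - y ^ 2) (-(2 * x)) x := by
    simpa using (hasDerivAt_pow 2 x).const_sub 1
  have hi : HasDerivAt (fun y : ℝ => 1 + 1 / y ^ 2) (-2 / x ^ 3) x := by
    have := ((hasDerivAt_pow 2 x).inv (by positivity)).const_add 1
    simp only [one_div]
    refine this.congr_deriv ?_
    field_simp
    norm_num
    ring
  have h := ((hasDerivAt_log h0.ne').const_mul (-2)).add (hi.mul (hl.log hx))
  refine h.congr_deriv ?_
  field_simp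
  ring

lemma gg_cont_zero : ContinuousAt gg 0 := by
  have hl : HasDerivAt (fun y : ℝ => log (1 - y ^ 2)) 0 0 := by
    have h : HasDerivAt (fun y : ℝ => 1 - y ^ 2) 0 0 := by
      simpa using (hasDerivAt_pow 2 (0:ℝ)).const_sub 1
    simpa using h.log (by norm_num)
  have hs := hasDerivAt_iff_tendsto_slope_zero.mp hl
  have hc : ContinuousAt (fun y : ℝ => log (1 - y ^ 2) / y) 0 := by
    rw [continuousAt_iff_punctured_nhds]
    simp at hs
    simp only [div_zero]
    refine hs.congr (fun y => by ring)
  unfold gg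
  have h1 : ContinuousAt (fun y : ℝ => y * log y) 0 := Real.continuous_mul_log.continuousAt
  have h2 : ContinuousAt (fun y : ℝ => 1 - y ^ 2) 0 := by fun_prop
  exact (h1.const_mul (-2)).sub (h2.mul hc)

lemma gg_cont_pos (x : ℝ) (h : 0 < x) : ContinuousAt gg x := by
  have h1 : ContinuousAt (fun y : ℝ => y * log y) x := Real.continuous_mul_log.continuousAt
  have h2 : ContinuousAt (fun y : ℝ => ((1 - y ^ 2) * log (1 - y ^ 2)) / y) x := by
    refine ContinuousAt.div ?_ continuousAt_id h.ne'
    have : Continuous (fun y : ℝ => (1 - y ^ 2) * log (1 - y ^ 2)) :=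
      Real.continuous_mul_log.comp (by fun_prop : Continuous (fun y : ℝ => 1 - y ^ 2))
    exact this.continuousAt
  have h3 := (h1.const_mul (-2)).sub h2
  refine h3.congr (Eventually.of_forall fun y => ?_)
  simp only [gg, Pi.sub_apply]
  ring

lemma second_neg (q : ℝ) (h0 : 0 < q) (h1 : q < 1 / 2) :
    (-4 / (q * (1 - q ^ 2)) + 2 * q * (-log (1 - q ^ 2) / (q ^ 2) ^ 2)) -
    (-4 / ((1 - q) * (1 - (1 - q) ^ 2)) +
      2 * (1 - q) * (-log (1 - (1 - q) ^ 2) / ((1 - q) ^ 2) ^ 2)) < 0 := by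
  have hp : 0 < 1 - q := by linarith
  rw [log_eq_tN _ (by positivity), log_eq_tN _ (by positivity)]
  have hm := tN_mono (q ^ 2) ((1 - q) ^ 2) (by positivity) (by nlinarith) (by nlinarith)
  have hn := tN_nonneg (q ^ 2) (by positivity) (by nlinarith)
  have hT : q * tN (q ^ 2) ≤ (1 - q) * tN ((1 - q) ^ 2) := by
    apply mul_le_mul _ hm hn hp.le
    linarith
  have hpq : 0 < q * (1 - q) := by positivity
  have e : (-4 / (q * (1 - q ^ 2)) + 2 * q * (1 / q ^ 2 + 1 / 2)) -
      (-4 / ((1 - q) * (1 - (1 - q) ^ 2)) + 2 * (1 - q) * (1 / (1 - q) ^ 2 + 1 / 2))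
      = -(1 - 2 * q) * (q * (1 - q)) / (2 + q * (1 - q)) := by
    have a1 : 1 - q ^ 2 = (1 - q) * (1 + q) := by ring
    have a2 : 1 - (1 - q) ^ 2 = q * (2 - q) := by ring
    have a3 : 2 + q * (1 - q) = (1 + q) * (2 - q) := by ring
    have : 2 - q ≠ 0 := by linarith
    have : 1 + q ≠ 0 := by linarith
    rw [a1, a2, a3]
    field_simp
    ring
  have f : -(1 - 2 * q) * (q * (1 - q)) / (2 + q * (1 - q)) < 0 := by
    apply div_neg_of_neg_of_pos
    · nlinarith [mul_pos hpq (by linarith : 0 < 1 - 2 * q)]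
    · positivity
  nlinarith

lemma two_case (q : ℝ) (h0 : 0 < q) (h1 : q < 1 / 2) : gg (1 - q) < gg q := by
  have hd1 : ∀ x : ℝ, 0 < x → x < 1 → HasDerivAt (fun q => gg q - gg (1 - q))
      ((-2 * log x + (1 + 1 / x ^ 2) * log (1 - x ^ 2)) +
       (-2 * log (1 - x) + (1 + 1 / (1 - x) ^ 2) * log (1 - (1 - x) ^ 2))) x := by
    intro x hx hx1
    have hl : HasDerivAt (fun y : ℝ => 1 - y) (-1) x := by
      simpa using (hasDerivAt_id x).const_sub 1
    refine ((gg_deriv x hx hx1).sub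
      ((gg_deriv (1 - x) (by linarith) (by linarith)).comp x hl)).congr_deriv ?_
    ring
  have hc : StrictConcaveOn ℝ (Icc (0:ℝ) (1 / 2)) (fun q => gg q - gg (1 - q)) := by
    apply strictConcaveOn_of_deriv2_neg (convex_Icc _ _)
    · intro x hx
      apply ContinuousAt.continuousWithinAt
      refine ContinuousAt.sub ?_ ?_
      · rcases hx.1.eq_or_lt with h | h
        · rw [← h]; exact gg_cont_zero
        · exact gg_cont_pos x h
      · exact ContinuousAt.comp (f := fun q : ℝ => 1 - q)
          (gg_cont_pos (1 - x) (by linarith [hx.2])) (by fun_prop)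
    · intro x hx
      rw [interior_Icc] at hx
      obtain ⟨hx0, hx1⟩ := hx
      have hev : deriv (fun q => gg q - gg (1 - q)) =ᶠ[𝓝 x] fun x =>
          ((-2 * log x + (1 + 1 / x ^ 2) * log (1 - x ^ 2)) +
           (-2 * log (1 - x) + (1 + 1 / (1 - x) ^ 2) * log (1 - (1 - x) ^ 2))) := by
        filter_upwards [Ioo_mem_nhds hx0 (by linarith : x < 1)] with y hy
        exact (hd1 y hy.1 hy.2).deriv
      have hl : HasDerivAt (fun y : ℝ => 1 - y) (-1) x := by
        simpa using (hasDerivAt_id x).const_sub 1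
      have h2 := (gg1_deriv x hx0 (by linarith)).add
        ((gg1_deriv (1 - x) (by linarith) (by linarith)).comp x hl)
      have h3 := h2.congr_of_eventuallyEq hev
      simp only [Function.iterate_succ, Function.iterate_zero, Function.comp, id]
      rw [h3.deriv]
      have := second_neg x hx0 hx1
      linarith
  have h := hc.2 (show (0:ℝ) ∈ Icc (0:ℝ) (1 / 2) by constructor <;> norm_num)
    (show (1 / 2 : ℝ) ∈ Icc (0:ℝ) (1 / 2) by constructor <;> norm_num) (by norm_num)
    (show 0 < 1 - 2 * q by linarith) (show 0 < 2 * q by linarith) (by ring)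
  have e : (1 - 2 * q) • (0:ℝ) + (2 * q) • (1 / 2 : ℝ) = q := by
    simp only [smul_eq_mul]; ring
  have e2 : (1 - 1 / 2 : ℝ) = 1 / 2 := by norm_num
  have e3 : gg 0 = 0 := by simp [gg]
  have e4 : gg 1 = 0 := by simp [gg]
  rw [e] at h
  simp only [e2, e3, e4, sub_zero, sub_self, smul_eq_mul, mul_zero, add_zero] at h
  linarith

lemma main_phi (a b : ℝ) (hb : 0 < b) (hab : b < a) (hs : a - b < 1)
    (hc : b ≤ ((1 - (a - b)) / 2) ^ 2) :
    (1 + (a - b)) * phi a < (1 - (a - b)) * phi b := by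
  obtain ⟨d, hd⟩ : ∃ d, d = a - b := ⟨_, rfl⟩
  have ha : a = b + d := by linarith
  rw [← hd] at hc hs ⊢
  have hd0 : 0 < d := by linarith
  set q := (1 - d) / 2 with hq
  have hq0 : 0 < q := by linarith
  have hq1 : q < 1 / 2 := by linarith
  have h2 := two_case q hq0 hq1
  rw [gg_phi q hq0, gg_phi (1 - q) (by linarith)] at h2
  have hbd : ∀ x ∈ Icc b (q ^ 2), 0 < x ∧ x + d < 1 ∧ x < 1 := by
    intro x hx
    have : x ≤ q ^ 2 := hx.2
    have : q ^ 2 + d < 1 := by nlinarith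
    exact ⟨hb.trans_le hx.1, by linarith, by linarith⟩
  have hder : ∀ x ∈ Icc b (q ^ 2), HasDerivAt (fun x => (1 - d) * phi x - (1 + d) * phi (x + d))
      ((1 - d) * (log (1 - x) / x ^ 2) - (1 + d) * (log (1 - (x + d)) / (x + d) ^ 2)) x := by
    intro x hx
    obtain ⟨g1, g2, g3⟩ := hbd x hx
    exact ((phi_deriv x g1 g3).const_mul _).sub
      (((phi_deriv (x + d) (by linarith) g2).comp_add_const x d).const_mul _)
  have hanti : AntitoneOn (fun x => (1 - d) * phi x - (1 + d) * phi (x + d)) (Icc b (q ^ 2)) := by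
    apply antitoneOn_of_deriv_nonpos (convex_Icc _ _)
    · intro x hx
      exact (hder x hx).continuousAt.continuousWithinAt
    · intro x hx
      exact (hder x (interior_subset hx)).differentiableAt.differentiableWithinAt
    · intro x hx
      have hx := interior_subset hx
      rw [(hder x hx).deriv]
      obtain ⟨g1, g2, g3⟩ := hbd x hx
      have hxq : x ≤ q ^ 2 := hx.2
      have hr := region (x + d) x g1 (by linarith) (by nlinarith) (by nlinarith)
      rw [add_sub_cancel_left] at hr
      simp only [neg_div] at hr
      linarith
  have h := hanti (left_mem_Icc.mpr hc) (right_mem_Icc.mpr hc) hc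
  simp only at h
  have e : q ^ 2 + d = (1 - q) ^ 2 := by rw [hq]; ring
  rw [e] at h
  rw [ha]
  have e1 : 1 - d = 2 * q := by rw [hq]; ring
  have e2 : 1 + d = 2 * (1 - q) := by rw [hq]; ring
  rw [e1, e2] at h ⊢
  linarith

lemma binH_phi (x : ℝ) (h : 0 < x) : binH x = x * phi x := by
  unfold binH phi
  field_simp

theorem stmt8 (n : ℕ) (hn : 2 ≤ n) (q p : ℝ) (hq : 0 < q) (hq2 : q < 1/2) (hp : p = 1 - q) :
    p^n * (1 + q^n - p^n) * binH (q^n) > q^n * (1 + p^n - q^n) * binH (p^n) := by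
  have hp0 : 0 < p := by linarith
  have hb : 0 < q ^ n := by positivity
  have ha : 0 < p ^ n := by positivity
  have hab : q ^ n < p ^ n := pow_lt_pow_left₀ (by linarith) hq.le (by omega)
  have ha2 : p ^ n ≤ p ^ 2 := pow_le_pow_of_le_one hp0.le (by linarith) hn
  have hb2 : q ^ n ≤ q ^ 2 := pow_le_pow_of_le_one hq.le (by linarith) hn
  rw [binH_phi _ hb, binH_phi _ ha]
  have hx : √(p ^ n) ≤ p := Real.sqrt_le_iff.mpr ⟨hp0.le, ha2⟩
  have hy : √(q ^ n) ≤ q := Real.sqrt_le_iff.mpr ⟨hq.le, hb2⟩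
  have hx2 := Real.sq_sqrt ha.le
  have hy2 := Real.sq_sqrt hb.le
  have hy0 := Real.sqrt_nonneg (q ^ n)
  have hxy : √(q ^ n) ≤ √(p ^ n) := Real.sqrt_le_sqrt hab.le
  have hd : p ^ n - q ^ n ≤ √(p ^ n) - √(q ^ n) := by nlinarith
  have hc : q ^ n ≤ ((1 - (p ^ n - q ^ n)) / 2) ^ 2 := by
    have : √(q ^ n) ≤ (1 - (p ^ n - q ^ n)) / 2 := by linarith
    calc q ^ n = √(q ^ n) ^ 2 := hy2.symm
      _ ≤ _ := by gcongr
  have h := main_phi (p ^ n) (q ^ n) hb hab (by nlinarith) hc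
  have h' := mul_lt_mul_of_pos_left h (mul_pos ha hb)
  nlinarith
end

section
/- For x, y ∈ (0,1) with x^(1/n) + y^(1/n) = 1 for some integer n ≥ 2 and x ≠ y, we have F(x,y) > 0, where F(x,y) = (1/(x-y))·((1+y-x)·h(y)/y - (1+x-y)·h(x)/x). -/
noncomputable def Fdef (x y : ℝ) : ℝ :=
  (1 / (x - y)) * ((1 + y - x) * binH y / y - (1 + x - y) * binH x / x)

lemma binH_pos {z : ℝ} (h0 : 0 < z) (h1 : z < 1) : 0 < binH z := by
  unfold binH
  have a := mul_pos h0 (neg_pos.2 (Real.log_neg h0 h1))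
  have b := mul_pos (sub_pos.2 h1) (neg_pos.2 (Real.log_neg (x := 1 - z) (by linarith) (by linarith)))
  linarith

lemma g_deriv {z : ℝ} (h0 : 0 < z) (h1 : z < 1) :
    HasDerivAt (fun z => binH z / z) (Real.log (1 - z) / z ^ 2) z := by
  unfold binH
  have h2 : (1 - z) ≠ 0 := by linarith
  have hl : HasDerivAt (fun z : ℝ => Real.log (1 - z)) (-1 / (1 - z)) z :=
    ((hasDerivAt_id z).const_sub 1).log h2
  have hm : HasDerivAt (fun z : ℝ => 1 - z) (-1) z := (hasDerivAt_id z).const_sub 1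
  have := ((((hasDerivAt_id z).neg).mul (Real.hasDerivAt_log h0.ne')).sub (hm.mul hl)).div
    (hasDerivAt_id z) h0.ne'
  refine this.congr_deriv ?_
  simp only [id, Pi.neg_apply, Pi.sub_apply, Pi.mul_apply]
  field_simp
  ring

lemma neglog_ge {y : ℝ} (h0 : 0 ≤ y) (h1 : y < 1) : y + y ^ 2 / 2 ≤ -Real.log (1 - y) := by
  have hs := Real.hasSum_pow_div_log_of_abs_lt_one (x := y) (by rw [abs_of_nonneg h0]; exact h1)
  have := sum_le_hasSum (Finset.range 2) (fun i _ => by positivity) hs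
  norm_num [Finset.sum_range_succ] at this
  linarith

/-- inequality (A) -/
lemma ineqA {s : ℝ} (h0 : 0 < s) (h1 : s ≤ 1 / 2) :
    s * binH (s ^ 2) < 2 * (1 - s) * -Real.log (1 - s ^ 2) := by
  have hl := neglog_ge (y := s ^ 2) (by positivity) (by nlinarith)
  have hlog : 1 - 1 / (2 * s) - 0.6931471808 ≤ Real.log s := by
    have h2 : Real.log (2 * s) = Real.log 2 + Real.log s := Real.log_mul (by norm_num) h0.ne'
    have h3 := Real.one_sub_inv_le_log_of_pos (x := 2 * s) (by positivity)
    have := Real.log_two_lt_d9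
    rw [inv_eq_one_div] at h3
    linarith
  have hlog2 : s * 0.3068528192 - 1 / 2 ≤ s * Real.log s := by
    have := mul_le_mul_of_nonneg_left hlog h0.le
    have e : s * (1 - 1 / (2 * s) - 0.6931471808) = s * 0.3068528192 - 1 / 2 := by
      field_simp; ring
    linarith
  unfold binH
  rw [Real.log_pow]
  set l := -Real.log (1 - s ^ 2) with hldef
  have hll : Real.log (1 - s ^ 2) = -l := by rw [hldef]; ring
  rw [hll]
  push_cast
  have hc : 0 < (1 - s) ^ 2 * (2 + s) := by
    have : 0 < 1 - s := by linarith
    positivity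
  have k1 := mul_le_mul_of_nonneg_left hl hc.le
  have k2 := mul_le_mul_of_nonneg_left hlog2 (sq_nonneg s)
  have k3 : 0 < (1 - s) ^ 2 * (2 + s) * (1 + s ^ 2 / 2) + 2 * (s * 0.3068528192 - 1 / 2) := by
    nlinarith [mul_nonneg h0.le (sub_nonneg.2 h1), mul_nonneg (sq_nonneg s) (sub_nonneg.2 h1),
      pow_pos h0 5, pow_pos h0 3, sq_nonneg (s - 1/2)]
  have k4 := mul_pos (pow_pos h0 2) k3
  nlinarith

/-- the tail `(-log(1-s²) - s² - s⁴/2)/s³` is monotone -/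
lemma tail_mono {s t : ℝ} (h0 : 0 < s) (hst : s ≤ t) (h1 : t < 1) :
    (-Real.log (1 - s ^ 2)) / s ^ 3 - 1 / s - s / 2 ≤
    (-Real.log (1 - t ^ 2)) / t ^ 3 - 1 / t - t / 2 := by
  have key : ∀ u : ℝ, 0 < u → u < 1 → HasSum (fun n : ℕ => u ^ (2 * n + 3) / ((n : ℝ) + 3))
      ((-Real.log (1 - u ^ 2)) / u ^ 3 - 1 / u - u / 2) := by
    intro u hu hu1
    have hs := Real.hasSum_pow_div_log_of_abs_lt_one (x := u ^ 2)
      (by rw [abs_of_nonneg (by positivity)]; nlinarith)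
    have h2 := ((hasSum_nat_add_iff' 2).2 hs).div_const (u ^ 3)
    have e1 : (fun n : ℕ => u ^ (2 * n + 3) / ((n : ℝ) + 3)) =
        fun i : ℕ => (u ^ 2) ^ (i + 2 + 1) / (((i + 2 : ℕ) : ℝ) + 1) / u ^ 3 := by
      funext n
      have e3 : ((n + 2 : ℕ) : ℝ) + 1 = (n : ℝ) + 3 := by push_cast; ring
      have e4 : (u ^ 2) ^ (n + 2 + 1) = u ^ (2 * n + 3) * u ^ 3 := by ring
      rw [e3, e4]
      field_simp
    have e2 : (-Real.log (1 - u ^ 2)) / u ^ 3 - 1 / u - u / 2 = (-Real.log (1 - u ^ 2)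
        - ∑ i ∈ Finset.range 2, (u ^ 2) ^ (i + 1) / ((i : ℝ) + 1)) / u ^ 3 := by
      norm_num [Finset.sum_range_succ]
      field_simp
      ring
    rw [e1, e2]
    exact h2
  refine hasSum_le (fun n => ?_) (key s h0 (by linarith)) (key t (by linarith) h1)
  gcongr

noncomputable def kk (s : ℝ) : ℝ := binH (s ^ 2) / s

noncomputable def kk1 (s : ℝ) : ℝ := -2 * Real.log s + (1 / s ^ 2 + 1) * Real.log (1 - s ^ 2)

lemma kk_eq (s : ℝ) : kk s = -2 * (s * Real.log s) - (1 / s - s) * Real.log (1 - s ^ 2) := by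
  unfold kk binH
  rw [Real.log_pow]
  by_cases h : s = 0
  · subst h; simp
  · push_cast; field_simp

lemma log1_deriv {s : ℝ} (h0 : 0 < s) (h1 : s < 1) :
    HasDerivAt (fun s : ℝ => Real.log (1 - s ^ 2)) (-(2 * s) / (1 - s ^ 2)) s := by
  have h2 : (1 - s ^ 2) ≠ 0 := by nlinarith
  have := ((hasDerivAt_pow 2 s).const_sub 1).log h2
  refine this.congr_deriv ?_
  simp

lemma kk_deriv {s : ℝ} (h0 : 0 < s) (h1 : s < 1) : HasDerivAt kk (kk1 s) s := by
  have e : kk = fun s => -2 * (s * Real.log s) - (1 / s - s) * Real.log (1 - s ^ 2) :=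
    funext kk_eq
  rw [e]
  have h2 : (1 - s ^ 2) ≠ 0 := by nlinarith
  have hi : HasDerivAt (fun s : ℝ => 1 / s - s) (-1 / s ^ 2 - 1) s := by
    have := (hasDerivAt_inv h0.ne').sub (hasDerivAt_id s)
    simp only [one_div]
    refine this.congr_deriv ?_
    ring
  have := (((hasDerivAt_id s).mul (Real.hasDerivAt_log h0.ne')).const_mul (-2)).sub
    (hi.mul (log1_deriv h0 h1))
  refine this.congr_deriv ?_
  simp only [id, kk1]
  field_simp
  ring

lemma kk1_deriv {s : ℝ} (h0 : 0 < s) (h1 : s < 1) :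
    HasDerivAt kk1 (-2 * (2 / (s * (1 - s ^ 2)) - (-Real.log (1 - s ^ 2)) / s ^ 3)) s := by
  have h2 : (1 - s ^ 2) ≠ 0 := by nlinarith
  have hi : HasDerivAt (fun s : ℝ => 1 / s ^ 2 + 1) (-2 / s ^ 3) s := by
    have := ((hasDerivAt_pow 2 s).inv (by positivity)).add_const 1
    simp only [one_div]
    refine this.congr_deriv ?_
    push_cast
    field_simp
  have := ((Real.hasDerivAt_log h0.ne').const_mul (-2)).add (hi.mul (log1_deriv h0 h1))
  unfold kk1
  refine this.congr_deriv ?_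
  field_simp
  ring

lemma kk2_lt {s : ℝ} (h0 : 0 < s) (h1 : s < 1 / 2) :
    2 / ((1 - s) * (1 - (1 - s) ^ 2)) - (-Real.log (1 - (1 - s) ^ 2)) / (1 - s) ^ 3 <
    2 / (s * (1 - s ^ 2)) - (-Real.log (1 - s ^ 2)) / s ^ 3 := by
  have h := tail_mono (s := s) (t := 1 - s) h0 (by linarith) (by linarith)
  have ht : 0 < 1 - s := by linarith
  have h3 : 0 < 2 - s := by linarith
  have e : 2 / (s * (1 - s ^ 2)) - 2 / ((1 - s) * (1 - (1 - s) ^ 2)) - (1 / s - 1 / (1 - s))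
      + ((1 - s) - s) / 2 = (1 - 2 * s) * (1 / 2 - 1 / (2 + s * (1 - s))) := by
    have e1 : 1 - s ^ 2 = (1 - s) * (1 + s) := by ring
    have e2 : 1 - (1 - s) ^ 2 = s * (2 - s) := by ring
    have e3 : 2 + s * (1 - s) = (1 + s) * (2 - s) := by ring
    rw [e1, e2, e3]
    have h4 : 1 + s ≠ 0 := by linarith
    field_simp
    ring
  have p : 0 < (1 - 2 * s) * (1 / 2 - 1 / (2 + s * (1 - s))) := by
    apply mul_pos (by linarith)
    have := mul_pos h0 ht
    rw [sub_pos]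
    apply one_div_lt_one_div_of_lt <;> linarith
  linarith

lemma kk_cont : ContinuousOn kk (Set.Icc 0 1) := by
  have e : kk = fun s => -2 * (s * Real.log s) - (dslope (fun s => Real.log (1 - s ^ 2)) 0 s
      - s * Real.log (1 - s ^ 2)) := by
    funext s
    rw [kk_eq]
    have hd0 : HasDerivAt (fun s : ℝ => Real.log (1 - s ^ 2)) 0 0 := by
      have := ((hasDerivAt_pow 2 (0:ℝ)).const_sub 1).log (by norm_num)
      exact this.congr_deriv (by simp)
    by_cases h : s = 0
    · subst h
      rw [dslope_same, hd0.deriv]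
      simp
    · rw [dslope_of_ne _ h, slope_def_field]
      simp
      field_simp
  have hds : ContinuousOn (fun s : ℝ => dslope (fun s => Real.log (1 - s ^ 2)) 0 s
      - s * Real.log (1 - s ^ 2)) (Set.Ico 0 1) := by
    have hdiff : ∀ z ∈ Set.Ico (0:ℝ) 1, DifferentiableAt ℝ (fun s => Real.log (1 - s ^ 2)) z := by
      intro z hz
      have : 1 - z ^ 2 ≠ 0 := by nlinarith [hz.1, hz.2]
      fun_prop (disch := assumption)
    intro z hz
    apply ContinuousAt.continuousWithinAt
    apply ContinuousAt.sub
    · by_cases h : z = 0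
      · subst h
        exact continuousAt_dslope_same.2 (hdiff 0 hz)
      · exact (continuousAt_dslope_of_ne h).2 (hdiff z hz).continuousAt
    · exact continuousAt_id.mul (hdiff z hz).continuousAt
  intro z hz
  rcases hz.2.eq_or_lt with h | h
  · -- near 1 use the entropy form
    have hcont : Continuous binH := by
      have e2 : binH = fun x => -(x * Real.log x) - (1 - x) * Real.log (1 - x) := by
        funext x; unfold binH; ring
      rw [e2]
      exact Real.continuous_mul_log.neg.sub
        (Real.continuous_mul_log.comp (continuous_const.sub continuous_id))
    apply ContinuousAt.continuousWithinAt
    unfold kk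
    exact (hcont.comp (continuous_pow 2)).continuousAt.div continuousAt_id (by simp [h])
  · have h2 : ContinuousWithinAt kk (Set.Ico 0 1) z := by
      rw [e]
      exact (Real.continuous_mul_log.const_mul (-2)).continuousWithinAt.sub (hds z ⟨hz.1, h⟩)
    refine h2.mono_of_mem_nhdsWithin ?_
    rw [mem_nhdsWithin]
    exact ⟨Set.Iio 1, isOpen_Iio, h, fun w hw => ⟨hw.2.1, hw.1⟩⟩

lemma ineqB {s : ℝ} (h0 : 0 < s) (h1 : s < 1 / 2) : kk (1 - s) < kk s := by
  have hd : ∀ u ∈ Set.Ioo (0:ℝ) (1/2), HasDerivAt (fun s => kk s - kk (1 - s))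
      (kk1 u + kk1 (1 - u)) u := by
    intro u hu
    have a := kk_deriv (s := 1 - u) (by linarith [hu.2]) (by linarith [hu.1])
    have b := a.comp u ((hasDerivAt_id u).const_sub 1)
    have := (kk_deriv (s := u) hu.1 (by linarith [hu.2])).sub b
    refine this.congr_deriv ?_
    ring
  have hd2 : ∀ u ∈ Set.Ioo (0:ℝ) (1/2), deriv (fun s => kk1 s + kk1 (1 - s)) u < 0 := by
    intro u hu
    have a := kk1_deriv (s := 1 - u) (by linarith [hu.2]) (by linarith [hu.1])
    have b := a.comp u ((hasDerivAt_id u).const_sub 1)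
    have := ((kk1_deriv (s := u) hu.1 (by linarith [hu.2])).add b).deriv
    have h3 := kk2_lt hu.1 hu.2
    change deriv (kk1 + kk1 ∘ HSub.hSub 1) u < 0
    rw [this]
    linarith
  have hc : StrictConcaveOn ℝ (Set.Icc (0:ℝ) (1/2)) (fun s => kk s - kk (1 - s)) := by
    apply strictConcaveOn_of_deriv2_neg (convex_Icc _ _)
    · apply ContinuousOn.sub
      · exact kk_cont.mono (Set.Icc_subset_Icc_right (by norm_num))
      · apply kk_cont.comp (by fun_prop)
        intro u hu
        exact ⟨by linarith [hu.2], by linarith [hu.1]⟩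
    · intro u hu
      rw [interior_Icc] at hu
      simp only [Function.iterate_succ, Function.iterate_zero, Function.comp, id]
      have : deriv (fun s => kk s - kk (1 - s)) =ᶠ[nhds u] fun s => kk1 s + kk1 (1 - s) := by
        filter_upwards [isOpen_Ioo.mem_nhds hu] with v hv
        exact (hd v hv).deriv
      rw [this.deriv_eq]
      exact hd2 u hu
  have hc2 := hc.2
  have m0 : (0:ℝ) ∈ Set.Icc (0:ℝ) (1/2) := by norm_num
  have m1 : (1/2:ℝ) ∈ Set.Icc (0:ℝ) (1/2) := by norm_num
  have l0 : 0 < 1 - 2 * s := by linarith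
  have l1 : 0 < 2 * s := by linarith
  have := hc2 m0 m1 (by norm_num) l0 l1 (by ring)
  have k0 : kk 0 = 0 := by simp [kk]
  have k1 : kk 1 = 0 := by simp [kk, binH]
  have e2 : (1 : ℝ) - 1/2 = 1/2 := by norm_num
  simp only [smul_eq_mul, e2, sub_zero, k0, k1, mul_zero, sub_self, add_zero, zero_add] at this
  have e3 : 2 * s * (1 / 2) = s := by ring
  rw [e3] at this
  linarith

noncomputable def GG (x z : ℝ) : ℝ :=
  Real.log (binH z / z) + Real.log (1 - x + z) - Real.log (1 + x - z)

lemma GG_deriv {x z : ℝ} (h0 : 0 < z) (hzx : z < x) (hx : x < 1) :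
    HasDerivAt (GG x) (Real.log (1 - z) / z ^ 2 / (binH z / z) + 1 / (1 - x + z)
      - (-1) / (1 + x - z)) z := by
  have hb := binH_pos h0 (hzx.trans hx)
  have a := (g_deriv h0 (hzx.trans hx)).log (by positivity)
  have b := ((hasDerivAt_id z).const_add (1 - x)).log (by simp; linarith)
  have c := ((hasDerivAt_id z).const_sub (1 + x)).log (by simp; linarith)
  exact (a.add b).sub c

lemma GG_cont {x z : ℝ} (h0 : 0 < z) (hzx : z ≤ x) (hx : x < 1) :
    ContinuousAt (GG x) z := by
  have hb := binH_pos h0 (hzx.trans_lt hx)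
  have a := (g_deriv h0 (hzx.trans_lt hx)).log (by positivity)
  have b := ((hasDerivAt_id z).const_add (1 - x)).log (by simp; linarith)
  have c := ((hasDerivAt_id z).const_sub (1 + x)).log (by simp; linarith)
  exact ((a.add b).sub c).continuousAt

lemma GG_neg {x s : ℝ} (h0 : 0 < s) (hs : s < 1 / 2) (hzx : s ^ 2 < x) (hx : x ≤ (1 - s) ^ 2) :
    Real.log (1 - s ^ 2) / (s ^ 2) ^ 2 / (binH (s ^ 2) / s ^ 2) + 1 / (1 - x + s ^ 2)
      - (-1) / (1 + x - s ^ 2) < 0 := by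
  have hA := ineqA h0 hs.le
  have hb := binH_pos (z := s ^ 2) (by positivity) (by nlinarith)
  set b := binH (s ^ 2)
  set l := -Real.log (1 - s ^ 2) with hl
  have hll : Real.log (1 - s ^ 2) = -l := by rw [hl]; ring
  rw [hll]
  have p1 : 0 < 1 - x + s ^ 2 := by nlinarith
  have p2 : 0 < 1 + x - s ^ 2 := by linarith
  have e : -l / (s ^ 2) ^ 2 / (b / s ^ 2) + 1 / (1 - x + s ^ 2) - (-1) / (1 + x - s ^ 2)
      = 2 / ((1 - x + s ^ 2) * (1 + x - s ^ 2)) - l / (s ^ 2 * b) := by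
    field_simp
    ring
  rw [e, sub_neg]
  have hprod : 4 * s * (1 - s) ≤ (1 - x + s ^ 2) * (1 + x - s ^ 2) := by nlinarith
  have h4 : 0 < 4 * s * (1 - s) := mul_pos (by linarith) (by linarith)
  calc 2 / ((1 - x + s ^ 2) * (1 + x - s ^ 2)) ≤ 2 / (4 * s * (1 - s)) := by gcongr
    _ < l / (s ^ 2 * b) := by
      rw [div_lt_div_iff₀ h4 (by positivity)]
      nlinarith [mul_lt_mul_of_pos_left hA h0]

lemma GG_anti {x y w : ℝ} (h0 : 0 < y) (hyw : y < w) (hwx : w ≤ x) (hx : x < 1)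
    (hw : w ≤ 1 / 4) (hs : √x + √w ≤ 1) : GG x w < GG x y := by
  have : StrictAntiOn (GG x) (Set.Icc y w) := by
    apply strictAntiOn_of_deriv_neg (convex_Icc _ _)
    · intro z hz
      exact (GG_cont (h0.trans_le hz.1) (hz.2.trans hwx) hx).continuousWithinAt
    · intro z hz
      rw [interior_Icc] at hz
      have hz0 : 0 < z := h0.trans hz.1
      have hzx : z < x := hz.2.trans_le hwx
      rw [(GG_deriv hz0 hzx hx).deriv]
      have hsq : √z ^ 2 = z := Real.sq_sqrt hz0.le
      have hs0 : 0 < √z := Real.sqrt_pos.2 hz0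
      have hsw : √z ≤ √w := Real.sqrt_le_sqrt hz.2.le
      have hxs : √x ^ 2 = x := Real.sq_sqrt (by linarith)
      have hx0 : 0 ≤ √x := Real.sqrt_nonneg x
      have hz2 : √z < 1 / 2 := by
        have : z < 1 / 4 := hz.2.trans_le hw
        nlinarith
      have hxx : x ≤ (1 - √z) ^ 2 := by
        rw [← hxs]
        apply pow_le_pow_left₀ hx0
        linarith
      have := GG_neg hs0 hz2 (by rw [hsq]; exact hzx) hxx
      rwa [hsq] at this
  exact this ⟨le_rfl, hyw.le⟩ ⟨hyw.le, le_rfl⟩ hyw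

lemma core {x y : ℝ} (h0 : 0 < y) (hyx : y < x) (hx : x < 1) (hs : √x + √y ≤ 1) :
    (1 + x - y) * (binH x / x) < (1 - x + y) * (binH y / y) := by
  have hx0 : 0 < x := h0.trans hyx
  have bx := binH_pos hx0 hx
  have bY := binH_pos h0 (hyx.trans hx)
  have gx : 0 < binH x / x := by positivity
  have gy : 0 < binH y / y := by positivity
  have p1 : 0 < 1 - x + y := by linarith
  have p2 : 0 < 1 + x - y := by linarith
  have main : Real.log (binH x / x) < GG x y := by
    have hxs : √x ^ 2 = x := Real.sq_sqrt hx0.le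
    have hys : √y ^ 2 = y := Real.sq_sqrt h0.le
    have hx1 : 0 < √x := Real.sqrt_pos.2 hx0
    have hy1 : 0 < √y := Real.sqrt_pos.2 h0
    rcases le_or_gt x (1 / 4) with h | h
    · have h2 : √x ≤ 1 / 2 := by nlinarith
      have := GG_anti h0 hyx le_rfl hx h (by linarith)
      have e : GG x x = Real.log (binH x / x) := by simp [GG]
      linarith
    · have h2 : 1 / 2 < √x := by nlinarith
      have h3 : √x < 1 := by nlinarith
      set s := 1 - √x with hsdef
      have hs0 : 0 < s := by linarith
      have hs2 : s < 1 / 2 := by linarith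
      have hxe : x = (1 - s) ^ 2 := by rw [← hxs, hsdef]; ring
      have hB := ineqB hs0 hs2
      have hle : GG x (s ^ 2) ≤ GG x y := by
        have hyle : y ≤ s ^ 2 := by
          rw [← hys]; exact pow_le_pow_left₀ hy1.le (by linarith) 2
        rcases hyle.eq_or_lt with h5 | h5
        · rw [← h5]
        · apply le_of_lt
          apply GG_anti h0 h5 (by nlinarith) hx (by nlinarith)
          rw [Real.sqrt_sq hs0.le, hsdef]; linarith
      refine lt_of_lt_of_le ?_ hle
      have bs := binH_pos (z := s ^ 2) (by positivity) (by nlinarith)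
      unfold GG
      have e1 : 1 - x + s ^ 2 = 2 * s := by rw [hxe]; ring
      have e2 : 1 + x - s ^ 2 = 2 * (1 - s) := by rw [hxe]; ring
      have q : 0 < 2 * (1 - s) := by linarith
      rw [e1, e2, lt_sub_iff_add_lt, ← Real.log_mul gx.ne' q.ne',
        ← Real.log_mul (by positivity) (by positivity)]
      apply Real.log_lt_log (by positivity)
      have e3 : binH x / x * (2 * (1 - s)) = 2 * kk (1 - s) := by
        unfold kk
        rw [hxe]
        have : 1 - s ≠ 0 := by linarith
        field_simp
      have e4 : binH (s ^ 2) / s ^ 2 * (2 * s) = 2 * kk s := by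
        unfold kk
        field_simp
      rw [e3, e4]
      linarith
  unfold GG at main
  rw [lt_sub_iff_add_lt, ← Real.log_mul gx.ne' p2.ne', ← Real.log_mul gy.ne' p1.ne'] at main
  have := (Real.log_lt_log_iff (by positivity) (by positivity)).1 main
  linarith

theorem stmt9 (x y : ℝ) (hx : x ∈ Set.Ioo (0:ℝ) 1) (hy : y ∈ Set.Ioo (0:ℝ) 1)
    (hxy : x ≠ y) (n : ℕ) (hn : 2 ≤ n)
    (h : x ^ (1 / (n:ℝ)) + y ^ (1 / (n:ℝ)) = 1) :
    Fdef x y > 0 := by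
  have hb : ∀ z ∈ Set.Ioo (0:ℝ) 1, √z ≤ z ^ (1 / (n:ℝ)) := by
    intro z hz
    rw [Real.sqrt_eq_rpow]
    apply Real.rpow_le_rpow_of_exponent_ge hz.1 hz.2.le
    have : (2:ℝ) ≤ n := by exact_mod_cast hn
    exact one_div_le_one_div_of_le (by norm_num) this
  have hs : √x + √y ≤ 1 := by linarith [hb x hx, hb y hy]
  unfold Fdef
  rcases lt_or_gt_of_ne hxy with hlt | hlt
  · have := core hx.1 hlt hy.2 (by linarith)
    apply mul_pos_of_neg_of_neg
    · exact one_div_neg.2 (by linarith)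
    · rw [mul_div_assoc, mul_div_assoc]
      have e1 : 1 - y + x = 1 + x - y := by ring
      rw [e1] at this
      linarith
  · have := core hy.1 hlt hx.2 hs
    apply mul_pos
    · exact one_div_pos.2 (by linarith)
    · rw [mul_div_assoc, mul_div_assoc]
      have e1 : 1 - x + y = 1 + y - x := by ring
      rw [e1] at this
      linarith
end
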